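/- Let G be a finite group, let R(G) be the ring of virtual complex characters of G, and let R_Q(G) be the subring of R(G) generated by the characters afforded by finite-dimensional QG-modules. If χ is a unit of R_Q(G), then the function g ↦ χ(1)·χ(g) is a group homomorphism from G to the subgroup {1,−1} of the multiplicative group of the complex numbers. -/

import Mathlib

set_option linter.unusedSectionVars false
set_option linter.unusedVariables false

open scoped Classical

namespace LB
noncomputable section

/-- The ring `R(G)` of virtual `ℂ`-characters of `G`, viewed inside the pointwise ring
of functions `G → ℂ`: the subring generated by the characters of finite-dimensional
complex representations of `G`. -/
def RC (G : Type*) [Group G] : Subring (G → ℂ) :=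
  Subring.closure
    {χ : G → ℂ | ∃ (V : Type) (_ : AddCommGroup V) (_ : Module ℂ V)
      (_ : FiniteDimensional ℂ V) (ρ : Representation ℂ G V),
      χ = fun g => LinearMap.trace ℂ V (ρ g)}

/-- The subring `R_ℚ(G)` of `R(G)` generated by the characters afforded by
finite-dimensional `ℚG`-modules. -/
def RQ (G : Type*) [Group G] : Subring (G → ℂ) :=
  Subring.closure
    {χ : G → ℂ | ∃ (V : Type) (_ : AddCommGroup V) (_ : Module ℚ V)
      (_ : FiniteDimensional ℚ V) (ρ : Representation ℚ G V),
      χ = fun g => ((LinearMap.trace ℚ V (ρ g) : ℚ) : ℂ)}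

open Module in
theorem aux_trace_exact {N V Q : Type} [AddCommGroup N] [Module ℚ N] [FiniteDimensional ℚ N]
    [AddCommGroup V] [Module ℚ V] [FiniteDimensional ℚ V]
    [AddCommGroup Q] [Module ℚ Q] [FiniteDimensional ℚ Q]
    (i : N →ₗ[ℚ] V) (q : V →ₗ[ℚ] Q) (hi : Function.Injective i) (hq : Function.Surjective q)
    (hiq : Function.Exact i q) (f' : N →ₗ[ℚ] N) (f : V →ₗ[ℚ] V) (f'' : Q →ₗ[ℚ] Q)
    (h1 : f ∘ₗ i = i ∘ₗ f') (h2 : q ∘ₗ f = f'' ∘ₗ q) :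
    LinearMap.trace ℚ V f = LinearMap.trace ℚ N f' + LinearMap.trace ℚ Q f'' := by
  obtain ⟨s, hs⟩ := q.exists_rightInverse_of_surjective (LinearMap.range_eq_top.2 hq)
  obtain ⟨p, hp⟩ := i.exists_leftInverse_of_injective (LinearMap.ker_eq_bot.2 hi)
  have hs' : ∀ x, q (s x) = x := fun x => by simpa using LinearMap.congr_fun hs x
  have hp' : ∀ x, p (i x) = x := fun x => by simpa using LinearMap.congr_fun hp x
  let π : V →ₗ[ℚ] N := p ∘ₗ (LinearMap.id - s ∘ₗ q)
  have hπ : i ∘ₗ π + s ∘ₗ q = LinearMap.id := by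
    ext v
    have : q (v - s (q v)) = 0 := by simp [hs']
    obtain ⟨w, hw⟩ := (hiq _).1 this
    have h3 : i (p (v - s (q v))) = v - s (q v) := by rw [← hw, hp']
    simp only [π, LinearMap.add_apply, LinearMap.comp_apply, LinearMap.sub_apply,
      LinearMap.id_apply, h3]
    abel
  have hπi : π ∘ₗ i = LinearMap.id := by
    ext v
    have : q (i v) = 0 := (hiq _).2 ⟨v, rfl⟩
    simp [π, this, hp']
  have e : f = (f ∘ₗ i) ∘ₗ π + (f ∘ₗ s) ∘ₗ q := by
    conv_lhs => rw [← LinearMap.comp_id f, ← hπ]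
    rw [LinearMap.comp_add]; rfl
  rw [e, map_add, h1, LinearMap.trace_comp_comm' π (i ∘ₗ f'), ← LinearMap.comp_assoc, hπi,
    LinearMap.trace_comp_comm' q (f ∘ₗ s), ← LinearMap.comp_assoc, h2, LinearMap.comp_assoc, hs]
  simp

theorem aux_trace_int {V : Type} [AddCommGroup V] [Module ℚ V] [FiniteDimensional ℚ V]
    (f : Module.End ℚ V) (n : ℕ) (hn : 0 < n) (hf : f ^ n = 1) :
    ∃ m : ℤ, LinearMap.trace ℚ V f = m := by
  let b := Module.Free.chooseBasis ℚ V
  let M := LinearMap.toMatrix b b f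
  have hM : M ^ n = 1 := by
    have : LinearMap.toMatrixAlgEquiv b (f ^ n) = 1 := by rw [hf, map_one]
    rwa [map_pow] at this
  let C := M.map (algebraMap ℚ ℂ)
  have hC : C ^ n = 1 := by
    have : (algebraMap ℚ ℂ).mapMatrix (M ^ n) = 1 := by rw [hM, map_one]
    rwa [map_pow] at this
  have htr : C.trace = ((LinearMap.trace ℚ V f : ℚ) : ℂ) := by
    rw [LinearMap.trace_eq_matrix_trace ℚ b]
    simp [C, M, Matrix.trace]
  have hint : IsIntegral ℤ C.trace := by
    rw [Matrix.trace_eq_sum_roots_charpoly]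
    apply IsIntegral.multiset_sum
    intro μ hμ
    have h1 : μ ∈ spectrum ℂ C :=
      Matrix.mem_spectrum_iff_isRoot_charpoly.2 (Polynomial.isRoot_of_mem_roots hμ)
    have h2 := spectrum.pow_mem_pow C n h1
    rw [hC] at h2
    have : μ ^ n = 1 := by
      by_contra hne
      apply h2
      rw [← map_one (algebraMap ℂ (Matrix _ _ ℂ)), spectrum.mem_resolventSet_iff, ← map_sub]
      exact (IsUnit.mk0 _ (sub_ne_zero.2 hne)).map _
    exact IsIntegral.of_pow hn (this ▸ isIntegral_one)
  rw [htr] at hint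
  have : IsIntegral ℤ (LinearMap.trace ℚ V f) :=
    (isIntegral_algebraMap_iff (algebraMap ℚ ℂ).injective).1 hint
  obtain ⟨m, hm⟩ := IsIntegrallyClosed.isIntegral_iff.1 this
  exact ⟨m, by simpa using hm.symm⟩

def IsDiff (G : Type*) [Group G] (d : G → ℚ) (n : ℕ) : Prop :=
  ∃ (V : Type) (_ : AddCommGroup V) (_ : Module ℚ V) (_ : FiniteDimensional ℚ V)
    (W : Type) (_ : AddCommGroup W) (_ : Module ℚ W) (_ : FiniteDimensional ℚ W)
    (ρ : Representation ℚ G V) (σ : Representation ℚ G W),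
    d = ρ.character - σ.character ∧ Module.finrank ℚ V + Module.finrank ℚ W = n

theorem aux_char_prod {G : Type*} [Group G] {V W : Type} [AddCommGroup V] [Module ℚ V]
    [FiniteDimensional ℚ V] [AddCommGroup W] [Module ℚ W] [FiniteDimensional ℚ W]
    (ρ : Representation ℚ G V) (σ : Representation ℚ G W) :
    (ρ.prod σ).character = ρ.character + σ.character := by
  ext g
  exact LinearMap.trace_prodMap' (ρ g) (σ g)

theorem aux_neg {G : Type*} [Group G] {d : G → ℚ} {n : ℕ} (h : IsDiff G d n) :
    IsDiff G (-d) n := by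
  obtain ⟨V, _, _, _, W, _, _, _, ρ, σ, rfl, hn⟩ := h
  exact ⟨W, _, _, ‹_›, V, _, _, ‹_›, σ, ρ, by simp, by omega⟩

theorem aux_exists {G : Type*} [Group G] {χ : G → ℂ} (h : χ ∈ RQ G) :
    ∃ d n, IsDiff G d n ∧ χ = fun g => ((d g : ℚ) : ℂ) := by
  unfold RQ at h
  induction h using Subring.closure_induction with
  | mem x hx =>
    obtain ⟨V, _, _, _, ρ, rfl⟩ := hx
    refine ⟨ρ.character, _, ⟨V, _, _, ‹_›, PUnit, inferInstance, inferInstance, inferInstance, ρ,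
      Representation.trivial ℚ G PUnit, ?_, rfl⟩, rfl⟩
    ext g
    simp [Representation.character]
  | zero =>
    refine ⟨0, _, ⟨PUnit, inferInstance, inferInstance, inferInstance, PUnit, inferInstance,
      inferInstance, inferInstance, Representation.trivial ℚ G PUnit,
      Representation.trivial ℚ G PUnit, by simp, rfl⟩, by ext; simp⟩
  | one =>
    refine ⟨1, _, ⟨ℚ, inferInstance, inferInstance, inferInstance, PUnit, inferInstance,
      inferInstance, inferInstance, Representation.trivial ℚ G ℚ,
      Representation.trivial ℚ G PUnit, ?_, rfl⟩, by ext; simp⟩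
    ext g
    have : Representation.trivial ℚ G ℚ g = 1 := rfl
    simp [Representation.character, this]
  | add x y _ _ hx hy =>
    obtain ⟨d, n, ⟨V, _, _, _, W, _, _, _, ρ, σ, rfl, hn⟩, rfl⟩ := hx
    obtain ⟨d', n', ⟨V', _, _, _, W', _, _, _, ρ', σ', rfl, hn'⟩, rfl⟩ := hy
    refine ⟨_, _, ⟨V × V', inferInstance, inferInstance, inferInstance, W × W', inferInstance,
      inferInstance, inferInstance, ρ.prod ρ', σ.prod σ', rfl, rfl⟩, ?_⟩
    ext g
    simp [aux_char_prod]; ring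
  | neg x _ hx =>
    obtain ⟨d, n, h, rfl⟩ := hx
    exact ⟨-d, n, aux_neg h, by ext; simp⟩
  | mul x y _ _ hx hy =>
    obtain ⟨d, n, ⟨V, _, _, _, W, _, _, _, ρ, σ, rfl, hn⟩, rfl⟩ := hx
    obtain ⟨d', n', ⟨V', _, _, _, W', _, _, _, ρ', σ', rfl, hn'⟩, rfl⟩ := hy
    refine ⟨_, _, ⟨TensorProduct ℚ V V' × TensorProduct ℚ W W', inferInstance, inferInstance,
      inferInstance, TensorProduct ℚ V W' × TensorProduct ℚ W V', inferInstance,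
      inferInstance, inferInstance, (ρ.tprod ρ').prod (σ.tprod σ'),
      (ρ.tprod σ').prod (σ.tprod ρ'), rfl, rfl⟩, ?_⟩
    ext g
    simp [aux_char_prod]; ring

theorem aux_int {G : Type*} [Group G] [Finite G] {d : G → ℚ} {n : ℕ} (h : IsDiff G d n) (g : G) :
    ∃ m : ℤ, d g = m := by
  obtain ⟨V, _, _, _, W, _, _, _, ρ, σ, rfl, hn⟩ := h
  obtain ⟨a, ha⟩ := aux_trace_int (ρ g) (Nat.card G) Nat.card_pos
    (by rw [← map_pow, pow_card_eq_one', map_one])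
  obtain ⟨b, hb⟩ := aux_trace_int (σ g) (Nat.card G) Nat.card_pos
    (by rw [← map_pow, pow_card_eq_one', map_one])
  exact ⟨a - b, by simp [Representation.character, ha, hb]⟩

theorem aux_reduce {G : Type*} [Group G] {V W : Type} [AddCommGroup V] [Module ℚ V]
    [FiniteDimensional ℚ V] [AddCommGroup W] [Module ℚ W] [FiniteDimensional ℚ W]
    (ρ : Representation ℚ G V) (σ : Representation ℚ G W)
    (φ : Representation.IntertwiningMap ρ σ) (hφ : φ ≠ 0) :
    ∃ m, m < Module.finrank ℚ V + Module.finrank ℚ W ∧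
      IsDiff G (ρ.character - σ.character) m := by
  let f := φ.toLinearMap
  have hf : ∀ g v, f (ρ g v) = σ g (f v) := fun g v => Representation.IntertwiningMap.isIntertwining _ _ φ g v
  have hf0 : f ≠ 0 := fun h => hφ (Representation.IntertwiningMap.ext h)
  have hK : ∀ g, LinearMap.ker f ≤ (LinearMap.ker f).comap (ρ g) := by
    intro g v hv
    have hv' : f v = 0 := hv
    simp [hf, hv']
  have hR : ∀ g, LinearMap.range f ≤ (LinearMap.range f).comap (σ g) := by
    rintro g _ ⟨v, rfl⟩
    exact ⟨ρ g v, hf g v⟩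
  have hpos : 0 < Module.finrank ℚ (LinearMap.range f) := by
    have : Nontrivial (LinearMap.range f) :=
      Submodule.nontrivial_iff_ne_bot.2 (fun h => hf0 (LinearMap.range_eq_bot.1 h))
    exact Module.finrank_pos
  have r1 := LinearMap.finrank_range_add_finrank_ker f
  have r2 := Submodule.finrank_quotient_add_finrank (LinearMap.range f)
  refine ⟨_, ?_, ⟨LinearMap.ker f, inferInstance, inferInstance, inferInstance,
    W ⧸ LinearMap.range f, inferInstance, inferInstance, inferInstance,
    ρ.subrepresentation _ hK, σ.quotient _ hR, ?_, rfl⟩⟩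
  · omega
  · ext g
    have t1 := aux_trace_exact (LinearMap.ker f).subtype f.rangeRestrict
      (Submodule.subtype_injective _) f.surjective_rangeRestrict
      (by intro v; simp [Subtype.ext_iff])
      (ρ.subrepresentation _ hK g) (ρ g) (σ.subrepresentation _ hR g)
      (by ext v; simp) (by ext v; simp [hf])
    have t2 := aux_trace_exact (LinearMap.range f).subtype (LinearMap.range f).mkQ
      (Submodule.subtype_injective _) (Submodule.mkQ_surjective _)
      (by intro v; simp)
      (σ.subrepresentation _ hR g) (σ g) (σ.quotient _ hR g)
      (by ext v; simp) (by ext v; simp)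
    simp only [Pi.sub_apply, Representation.character, t1, t2]
    ring

theorem aux_key {G : Type*} [Group G] [Finite G] (d : G → ℚ) (n : ℕ) (hd : IsDiff G d n)
    (hpm : ∀ g, d g = 1 ∨ d g = -1) (h1 : d 1 = 1) (g h : G) : d (g * h) = d g * d h := by
  have hex : ∃ n, IsDiff G d n := ⟨n, hd⟩
  have hmin := fun m => Nat.find_min hex (m := m)
  obtain ⟨V, _, _, _, W, _, _, _, ρ, σ, hdef, hn⟩ := Nat.find_spec hex
  rw [← hn] at hmin
  have hzero : ∀ φ : Representation.IntertwiningMap ρ σ, φ = 0 := by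
    intro φ
    by_contra hne
    obtain ⟨m, hm, hm'⟩ := aux_reduce ρ σ φ hne
    exact hmin m hm (hdef ▸ hm')
  have hzero' : ∀ φ : Representation.IntertwiningMap σ ρ, φ = 0 := by
    intro φ
    by_contra hne
    obtain ⟨m, hm, hm'⟩ := aux_reduce σ ρ φ hne
    refine hmin m (by omega) ?_
    have := aux_neg hm'
    rwa [neg_sub, ← hdef] at this
  have : Fintype G := Fintype.ofFinite G
  have hc : (Nat.card G : ℚ) ≠ 0 := by exact_mod_cast Nat.card_pos.ne'
  have : Invertible (Nat.card G : ℚ) := invertibleOfNonzero hc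
  have : Subsingleton (Representation.IntertwiningMap ρ σ) :=
    ⟨fun a b => (hzero a).trans (hzero b).symm⟩
  have : Subsingleton (Representation.IntertwiningMap σ ρ) :=
    ⟨fun a b => (hzero' a).trans (hzero' b).symm⟩
  have e1 := Representation.card_inv_mul_sum_char_mul_char_eq_finrank ρ ρ
  have e2 := Representation.card_inv_mul_sum_char_mul_char_eq_finrank σ σ
  have e3 := Representation.card_inv_mul_sum_char_mul_char_eq_finrank ρ σ
  have e4 := Representation.card_inv_mul_sum_char_mul_char_eq_finrank σ ρ
  rw [Module.finrank_zero_of_subsingleton] at e3 e4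
  have hsum : (Nat.card G : ℚ)⁻¹ * ∑ g : G, d g * d g⁻¹ =
      Module.finrank ℚ (Representation.IntertwiningMap ρ ρ) +
      Module.finrank ℚ (Representation.IntertwiningMap σ σ) := by
    rw [← e1, ← e2]
    have : ∑ g : G, d g * d g⁻¹ = ∑ g : G, ρ.character g * ρ.character g⁻¹ +
        ∑ g : G, σ.character g * σ.character g⁻¹ - ∑ g : G, σ.character g * ρ.character g⁻¹
        - ∑ g : G, ρ.character g * σ.character g⁻¹ := by
      rw [← Finset.sum_add_distrib, ← Finset.sum_sub_distrib, ← Finset.sum_sub_distrib]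
      refine Finset.sum_congr rfl fun g _ => ?_
      rw [hdef]; simp only [Pi.sub_apply]; ring
    rw [this, mul_sub, mul_sub, e3, e4, mul_add]
    simp
  have hle : (Nat.card G : ℚ)⁻¹ * ∑ g : G, d g * d g⁻¹ ≤ 1 := by
    have : ∑ g : G, d g * d g⁻¹ ≤ ∑ g : G, (1 : ℚ) := by
      refine Finset.sum_le_sum fun g _ => ?_
      rcases hpm g with h | h <;> rcases hpm g⁻¹ with h' | h' <;> rw [h, h'] <;> norm_num
    calc _ ≤ (Nat.card G : ℚ)⁻¹ * ∑ g : G, (1 : ℚ) := by gcongr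
      _ = 1 := by
        rw [Finset.sum_const, Finset.card_univ, Fintype.card_eq_nat_card, nsmul_eq_mul, mul_one,
          inv_mul_cancel₀ hc]
  rw [hsum] at hle
  have hle' : Module.finrank ℚ (Representation.IntertwiningMap ρ ρ) +
      Module.finrank ℚ (Representation.IntertwiningMap σ σ) ≤ 1 := by exact_mod_cast hle
  have hdim : Module.finrank ℚ V = Module.finrank ℚ W + 1 := by
    have := h1
    rw [hdef, Pi.sub_apply, Representation.char_one, Representation.char_one] at this
    have : (Module.finrank ℚ V : ℚ) = Module.finrank ℚ W + 1 := by linarith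
    exact_mod_cast this
  have hfin : ∀ {U : Type} [AddCommGroup U] [Module ℚ U] [FiniteDimensional ℚ U]
      (τ : Representation ℚ G U), 0 < Module.finrank ℚ U →
      0 < Module.finrank ℚ (Representation.IntertwiningMap τ τ) := by
    intro U _ _ _ τ hU
    have : Nontrivial U := Module.finrank_pos_iff.1 hU
    have : Module.Finite ℚ (Representation.IntertwiningMap τ τ) :=
      Module.Finite.equiv (Representation.invariantsEquivIntertwiningMap τ τ)
    have : Nontrivial (Representation.IntertwiningMap τ τ) := by
      refine ⟨Representation.IntertwiningMap.id τ, 0, fun h => ?_⟩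
      obtain ⟨u, hu⟩ := exists_ne (0 : U)
      apply hu
      have := congrArg (fun k : Representation.IntertwiningMap τ τ => k u) h
      simpa using this
    exact Module.finrank_pos
  have hV := hfin ρ (by omega)
  have hW : Module.finrank ℚ W = 0 := by
    by_contra hne
    have := hfin σ (Nat.pos_of_ne_zero hne)
    omega
  have hV1 : Module.finrank ℚ V = 1 := by omega
  have : Subsingleton W := Module.finrank_zero_iff.1 hW
  have hdρ : ∀ g, d g = LinearMap.trace ℚ V (ρ g) := by
    intro g
    have : σ g = 0 := LinearMap.ext fun w => Subsingleton.elim _ _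
    rw [hdef]; simp [Representation.character, this]
  have hscal : ∀ g, ∃ c : ℚ, ρ g = c • (1 : Module.End ℚ V) := by
    intro g
    obtain ⟨v, hv, hv'⟩ := finrank_eq_one_iff'.1 hV1
    obtain ⟨c, hc⟩ := hv' (ρ g v)
    refine ⟨c, LinearMap.ext fun w => ?_⟩
    obtain ⟨a, rfl⟩ := hv' w
    simp [← hc, smul_comm a c]
  obtain ⟨a, ha⟩ := hscal g
  obtain ⟨b, hb⟩ := hscal h
  have tr1 : LinearMap.trace ℚ V 1 = 1 := by rw [LinearMap.trace_one, hV1]; simp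
  rw [hdρ, hdρ, hdρ, map_mul, ha, hb, smul_mul_smul_comm, one_mul, map_smul, map_smul, map_smul,
    tr1]
  simp

/-- If `χ` is a unit of `R_ℚ(G)`, then `g ↦ χ(1)·χ(g)` is a group
homomorphism from `G` to the subgroup `{1, -1}` of `ℂˣ`. -/
theorem unit_of_RQ_is_sign_homomorphism (G : Type*) [Group G] [Finite G]
    (χ : G → ℂ) (hχ : χ ∈ RQ G)
    (hunit : ∃ χ' ∈ RQ G, χ * χ' = 1) :
    (∀ g : G, χ 1 * χ g = 1 ∨ χ 1 * χ g = -1) ∧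
    (∀ g h : G, χ 1 * χ (g * h) = (χ 1 * χ g) * (χ 1 * χ h)) := by
  obtain ⟨χ', hχ', hmul⟩ := hunit
  obtain ⟨d, n, hd, rfl⟩ := aux_exists hχ
  obtain ⟨d', n', hd', rfl⟩ := aux_exists hχ'
  have hpm : ∀ g, d g = 1 ∨ d g = -1 := by
    intro g
    obtain ⟨m, hm⟩ := aux_int hd g
    obtain ⟨m', hm'⟩ := aux_int hd' g
    have h1 := congrFun hmul g
    simp only [Pi.mul_apply, Pi.one_apply, hm, hm'] at h1
    have h2 : m * m' = 1 := by exact_mod_cast h1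
    rcases Int.eq_one_or_neg_one_of_mul_eq_one h2 with h | h
    · left; rw [hm, h]; norm_num
    · right; rw [hm, h]; norm_num
  constructor
  · intro g
    rcases hpm 1 with h | h <;> rcases hpm g with h' | h' <;> simp [h, h']
  · intro g h
    rcases hpm 1 with h1 | h1
    · have := aux_key d n hd hpm h1 g h
      simp [h1, this]
    · have := aux_key (-d) n (aux_neg hd) (fun g => by
        rcases hpm g with h | h <;> simp [h]) (by simp [h1]) g h
      simp only [Pi.neg_apply] at this
      have h3 : d (g * h) = - (d g * d h) := by linarith
      simp [h1, h3]

end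
end LB
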